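/- For every d ≥ 0 and every x ∈ {0,1}^(4^d): the positive witness size w_+(x, P_{G_d}) is finite if and only if NAND_{2d}(x) = 1, and the negative witness size w_-(x, P_{G_d}) is finite if and only if NAND_{2d}(x) = 0. In other words, the span program P_{G_d} decides the depth-2d NAND-tree evaluation problem. -/

import Mathlib

open scoped ENNReal
open scoped Classical

namespace NandTree

/-- The bit-`b` half of an input of length `2^(m+1)`: `b = false` gives the first half,
`b = true` the second half (lexicographic indexing, first bit most significant). -/
def halfInput (m : ℕ) (b : Bool) (x : Fin (2^(m+1)) → Bool) : Fin (2^m) → Bool :=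
  fun i => x ⟨(cond b 1 0) * 2^m + i.val, by
    have h := i.isLt
    have h2 : (2:ℕ)^(m+1) = 2^m * 2 := pow_succ 2 m
    cases b <;> simp only [cond_true, cond_false] <;> omega⟩

/-- The value `NAND_ℓ(x)` of a depth-`ℓ` NAND-tree instance: internal nodes at even
distance from the leaves are OR gates, at odd distance AND gates. -/
def nand : (ℓ : ℕ) → (Fin (2^ℓ) → Bool) → Bool
  | 0, x => x ⟨0, by norm_num⟩
  | (ℓ+1), x =>
    if (ℓ+1) % 2 = 0 then
      nand ℓ (halfInput ℓ false x) || nand ℓ (halfInput ℓ true x)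
    else
      nand ℓ (halfInput ℓ false x) && nand ℓ (halfInput ℓ true x)

/-- Index of a leaf given by a root-to-leaf bit string (lexicographic, first bit most
significant). -/
def leafIdx (s : List Bool) : ℕ := s.foldl (fun n b => 2 * n + cond b 1 0) 0

/-- The value of the leaf reached by bit string `s` in instance `x`. -/
def leafVal (m : ℕ) (x : Fin (2^m) → Bool) (s : List Bool) : Bool :=
  if h : leafIdx s < 2^m then x ⟨leafIdx s, h⟩ else false

/-- Edges of the graph `G_d`: `G_0` has a single edge; each edge `e` of `G_d` is replaced
by four edges `(e, b, c)` in `G_{d+1}`, where `b` selects one of the two length-2 paths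
and `c` selects the side (`false`: the `u`-side edge, `true`: the `v`-side edge). -/
def Edg : ℕ → Type
  | 0 => Unit
  | (d+1) => Edg d × Bool × Bool

/-- Vertices of `G_d`: `G_0` has vertices `s = false`, `t = true`; `G_{d+1}` has the
vertices of `G_d` plus one new middle vertex `(e, b)` for each edge `e` of `G_d` and
each of the two length-2 paths `b` replacing it. -/
def Vtx : ℕ → Type
  | 0 => Bool
  | (d+1) => Vtx d ⊕ (Edg d × Bool)

instance edgFintype : (d : ℕ) → Fintype (Edg d)
  | 0 => inferInstanceAs (Fintype Unit)
  | (d+1) => letI := edgFintype d; inferInstanceAs (Fintype (Edg d × Bool × Bool))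

instance edgDecEq : (d : ℕ) → DecidableEq (Edg d)
  | 0 => inferInstanceAs (DecidableEq Unit)
  | (d+1) => letI := edgDecEq d; inferInstanceAs (DecidableEq (Edg d × Bool × Bool))

instance vtxDecEq : (d : ℕ) → DecidableEq (Vtx d)
  | 0 => inferInstanceAs (DecidableEq Bool)
  | (d+1) => letI := edgDecEq d; letI := vtxDecEq d
             inferInstanceAs (DecidableEq (Vtx d ⊕ (Edg d × Bool)))

/-- The two endpoints of an edge of `G_d`: `ep d e false` is the `u`-end and
`ep d e true` is the `v`-end. -/
def ep : (d : ℕ) → Edg d → Bool → Vtx d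
  | 0, _, k => k
  | (d+1), (e, b, c), k =>
    match c, k with
    | false, false => Sum.inl (ep d e false)
    | false, true  => Sum.inr (e, b)
    | true,  false => Sum.inr (e, b)
    | true,  true  => Sum.inl (ep d e true)

/-- The vertex `s` of `G_d`. -/
def sVtx : (d : ℕ) → Vtx d
  | 0 => false
  | (d+1) => Sum.inl (sVtx d)

/-- The vertex `t` of `G_d`. -/
def tVtx : (d : ℕ) → Vtx d
  | 0 => true
  | (d+1) => Sum.inl (tVtx d)

/-- The label of an edge of `G_d`, a bit string of length `2d`: the edge of `G_0` is
labeled by the empty string, and the four edges replacing an edge labeled `τ` are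
labeled `τ00`, `τ01` (the two edges of the first path, `u`- and `v`-side) and
`τ10`, `τ11` (the two edges of the second path). -/
def elabel : (d : ℕ) → Edg d → List Bool
  | 0, _ => []
  | (d+1), (e, b, c) => elabel d e ++ [b, c]

/-- The input bit of `x` associated with edge `e` of `G_d` (bits of `x` indexed by the
edge labels in lexicographic order). -/
def edgeBit (d : ℕ) (x : Fin (2^(2*d)) → Bool) (e : Edg d) : Bool :=
  leafVal (2*d) x (elabel d e)

/-- The positive witness size `w₊(x, P_{G_d})` of the span program `P_{G_d}`: the least
squared norm of a vector `w`, supported on the directed edges available for input `x`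
(both orientations `(e, o)` of each edge `e` of `G_d` with `x`-bit `1`), such that
`A w = |s⟩ - |t⟩` where `A |(e,o)⟩ = |ep e o⟩ - |ep e (!o)⟩`; the infimum over the empty
set being `⊤ = ∞` when no witness exists. -/
noncomputable def posWit (d : ℕ) (x : Fin (2^(2*d)) → Bool) : ℝ≥0∞ :=
  ⨅ w ∈ {w : Edg d × Bool → ℝ |
      (∀ p : Edg d × Bool, w p ≠ 0 → edgeBit d x p.1 = true) ∧
      (∀ v : Vtx d,
        (∑ p : Edg d × Bool, w p *
          ((if ep d p.1 p.2 = v then (1:ℝ) else 0) - (if ep d p.1 (!p.2) = v then 1 else 0)))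
        = (if v = sVtx d then (1:ℝ) else 0) - (if v = tVtx d then 1 else 0))},
    ENNReal.ofReal (∑ p : Edg d × Bool, (w p)^2)

/-- The negative witness size `w₋(x, P_{G_d})` of the span program `P_{G_d}`: the least
value of `‖ω ∘ A‖² = Σ_{(e,o)} (ω(ep e o) - ω(ep e (!o)))²` over linear functionals
`ω : V(G_d) → ℝ` vanishing on `A(H(x))` (i.e. `ω(u) - ω(v) = 0` across every available
directed edge) with `ω(|s⟩ - |t⟩) = 1`; the infimum over the empty set being `⊤ = ∞`
when no witness exists. -/
noncomputable def negWit (d : ℕ) (x : Fin (2^(2*d)) → Bool) : ℝ≥0∞ :=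
  ⨅ ω ∈ {ω : Vtx d → ℝ |
      (∀ p : Edg d × Bool, edgeBit d x p.1 = true →
        ω (ep d p.1 p.2) - ω (ep d p.1 (!p.2)) = 0) ∧
      ω (sVtx d) - ω (tVtx d) = 1},
    ENNReal.ofReal (∑ p : Edg d × Bool, (ω (ep d p.1 p.2) - ω (ep d p.1 (!p.2)))^2)

/-- The two lowest levels of the tree, evaluated. -/
def red (m : ℕ) (x : Fin (2^(m+2)) → Bool) : Fin (2^m) → Bool := fun i =>
  have h : 4 * i.val + 3 < 2^(m+2) := by
    have h := i.isLt
    have h2 : (2:ℕ)^(m+2) = 2^m * 4 := pow_add 2 m 2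
    omega
  (x ⟨4 * i.val, by omega⟩ && x ⟨4 * i.val + 1, by omega⟩) ||
    (x ⟨4 * i.val + 2, by omega⟩ && x ⟨4 * i.val + 3, h⟩)

theorem nand_succ (l : ℕ) (x : Fin (2^(l+1)) → Bool) : nand (l+1) x =
    if (l+1) % 2 = 0 then
      nand l (halfInput l false x) || nand l (halfInput l true x)
    else
      nand l (halfInput l false x) && nand l (halfInput l true x) := rfl

theorem half_red (m : ℕ) (b : Bool) (x : Fin (2^(m+1+2)) → Bool) :
    halfInput m b (red (m+1) x) = red m (halfInput (m+2) b x) := by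
  funext i
  have h2 : (2:ℕ)^(m+2) = 2^m * 4 := pow_add 2 m 2
  cases b
  · simp [halfInput, red]
  · have e : 4 * (2^m + i.val) = 2^(m+2) + 4 * i.val := by omega
    simp [halfInput, red, e, add_assoc]

theorem nand_red (m : ℕ) (x : Fin (2^(m+2)) → Bool) : nand (m+2) x = nand m (red m x) := by
  induction m with
  | zero =>
    simp [nand, halfInput, red]
  | succ m ih =>
    rw [nand_succ m, half_red, half_red, ← ih, ← ih, nand_succ (m+2)]
    have : (m+2+1) % 2 = (m+1) % 2 := by omega
    rw [this]

theorem leafIdx_lt (d : ℕ) (e : Edg d) : leafIdx (elabel d e) < 2^(2*d) := by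
  induction d with
  | zero => simp [elabel, leafIdx]
  | succ d ih =>
    obtain ⟨e, b, c⟩ := e
    have h := ih e
    have h2 : (2:ℕ)^(2*(d+1)) = 2^(2*d) * 4 := pow_add 2 (2*d) 2
    simp only [elabel, leafIdx, List.foldl_append, List.foldl_cons, List.foldl_nil] at h ⊢
    cases b <;> cases c <;> simp only [cond_true, cond_false] <;> omega

/-- Evaluate the four edges replacing each edge. -/
def redE (d : ℕ) (f : Edg (d+1) → Bool) (e : Edg d) : Bool :=
  (f (e, false, false) && f (e, false, true)) || (f (e, true, false) && f (e, true, true))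

theorem leafIdx_snoc (l : List Bool) (b c : Bool) :
    leafIdx (l ++ [b, c]) = 4 * leafIdx l + (2 * cond b 1 0 + cond c 1 0) := by
  simp only [leafIdx, List.foldl_append, List.foldl_cons, List.foldl_nil]
  ring

theorem edgeBit_red (d : ℕ) (x : Fin (2^(2*d+2)) → Bool) (e : Edg d) :
    edgeBit d (red (2*d) x) e = redE d (edgeBit (d+1) x) e := by
  have h := leafIdx_lt d e
  have h2 : (2:ℕ)^(2*(d+1)) = 2^(2*d) * 4 := pow_add 2 (2*d) 2
  have key : ∀ b c, edgeBit (d+1) x (e, b, c) =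
      x ⟨4 * leafIdx (elabel d e) + (2 * cond b 1 0 + cond c 1 0), by
        change _ < 2^(2*(d+1))
        cases b <;> cases c <;> simp only [cond_true, cond_false] <;> omega⟩ := by
    intro b c
    have h3 : 4 * leafIdx (elabel d e) + (2 * cond b 1 0 + cond c 1 0) < 2^(2*(d+1)) := by
      cases b <;> cases c <;> simp only [cond_true, cond_false] <;> omega
    simp only [edgeBit, leafVal, elabel, leafIdx_snoc]
    rw [dif_pos h3]
  simp only [redE, key]
  simp [edgeBit, leafVal, h, red]

/-- Positive witness, tested against all potentials. -/
def PosW (d : ℕ) (f : Edg d → Bool) : Prop :=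
  ∃ w : Edg d × Bool → ℝ, (∀ p, w p ≠ 0 → f p.1 = true) ∧
    ∀ g : Vtx d → ℝ, ∑ p : Edg d × Bool, w p * (g (ep d p.1 p.2) - g (ep d p.1 (!p.2))) =
      g (sVtx d) - g (tVtx d)

/-- Negative witness. -/
def NegW (d : ℕ) (f : Edg d → Bool) : Prop :=
  ∃ ω : Vtx d → ℝ, (∀ p : Edg d × Bool, f p.1 = true →
      ω (ep d p.1 p.2) - ω (ep d p.1 (!p.2)) = 0) ∧ ω (sVtx d) - ω (tVtx d) = 1

theorem sum_edg_succ (d : ℕ) (F : Edg (d+1) × Bool → ℝ) :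
    ∑ p, F p = ∑ e : Edg d, ∑ b : Bool, ∑ c : Bool, ∑ o : Bool, F ((e, b, c), o) := by
  rw [Fintype.sum_prod_type]
  have : ∀ G : Edg (d+1) → ℝ, ∑ p, G p = ∑ e : Edg d, ∑ b : Bool, ∑ c : Bool, G (e, b, c) := by
    intro G
    have h := Fintype.sum_prod_type (fun p : Edg d × Bool × Bool => G p)
    simp only [Fintype.sum_prod_type] at h
    exact h
  exact this _

theorem posW_succ (d : ℕ) (f : Edg (d+1) → Bool) (h : PosW d (redE d f)) : PosW (d+1) f := by
  obtain ⟨w, hw, hg⟩ := h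
  refine ⟨fun p => if p.1.2.1 = !(f (p.1.1, false, false) && f (p.1.1, false, true))
    then w (p.1.1, p.2) else 0, ?_, ?_⟩
  · rintro ⟨⟨e, b, c⟩, o⟩ hp
    simp only [ne_eq, ite_eq_right_iff, Classical.not_imp] at hp
    have := hw (e, o) hp.2
    have h1 := hp.1
    simp only [redE] at this
    clear hp hw hg
    change f (e, b, c) = true
    change b = !(f (e, false, false) && f (e, false, true)) at h1
    revert this h1
    generalize h00 : f (e, false, false) = a00
    generalize h01 : f (e, false, true) = a01
    generalize h10 : f (e, true, false) = a10
    generalize h11 : f (e, true, true) = a11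
    cases b <;> cases c <;> simp only [h00, h01, h10, h11] <;> clear h00 h01 h10 h11 <;>
      revert a00 a01 a10 a11 <;> decide
  · intro g
    have := hg (fun v => g (Sum.inl v))
    rw [sum_edg_succ]
    simp only [sVtx, tVtx]
    rw [← this, Fintype.sum_prod_type]
    refine Finset.sum_congr rfl fun e _ => ?_
    simp only [Fintype.sum_bool, ep, Bool.not_true, Bool.not_false]
    cases (f (e, false, false) && f (e, false, true)) <;> simp <;> ring

theorem negW_succ (d : ℕ) (f : Edg (d+1) → Bool) (h : NegW d (redE d f)) : NegW (d+1) f := by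
  obtain ⟨ω, h0, h1⟩ := h
  refine ⟨fun v => Sum.elim ω (fun q => if f (q.1, q.2, false) = true
    then ω (ep d q.1 false) else ω (ep d q.1 true)) v, ?_, h1⟩
  rintro ⟨⟨e, b, c⟩, o⟩ hp
  have h2 : redE d f e = true → ω (ep d e false) = ω (ep d e true) := fun hr =>
    sub_eq_zero.1 (h0 (e, false) hr)
  simp only [redE] at h2
  cases b <;> cases c <;> cases o <;> simp only [ep, Bool.not_true, Bool.not_false,
    Sum.elim_inl, Sum.elim_inr] <;> simp only at hp <;> grind

theorem posW_of (d : ℕ) (x : Fin (2^(2*d)) → Bool) (h : nand (2*d) x = true) :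
    PosW d (edgeBit d x) := by
  induction d with
  | zero =>
    refine ⟨fun p => if p.2 = false then 1 else 0, fun p _ => ?_, fun g => ?_⟩
    · simpa [edgeBit, leafVal, elabel, leafIdx, nand] using h
    · have : ∀ F : Edg 0 × Bool → ℝ, ∑ p, F p = F ((), true) + F ((), false) := by
        intro F
        rw [Fintype.sum_prod_type]
        have h1 : ∀ G : Edg 0 → ℝ, ∑ p, G p = G () := fun G => Fintype.sum_unique (ι := Unit) G
        rw [h1, Fintype.sum_bool]
      rw [this]
      simp [ep, sVtx, tVtx]
  | succ d ih =>
    apply posW_succ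
    have h1 := ih (red (2*d) x) ((nand_red (2*d) x).symm.trans h)
    rwa [funext (edgeBit_red d x)] at h1

theorem negW_of (d : ℕ) (x : Fin (2^(2*d)) → Bool) (h : nand (2*d) x = false) :
    NegW d (edgeBit d x) := by
  induction d with
  | zero =>
    refine ⟨fun v => cond v 0 1, fun p hp => ?_, ?_⟩
    · have : edgeBit 0 x p.1 = false := by
        simpa [edgeBit, leafVal, elabel, leafIdx, nand] using h
      simp [this] at hp
    · simp [sVtx, tVtx]
  | succ d ih =>
    apply negW_succ
    have h1 := ih (red (2*d) x) ((nand_red (2*d) x).symm.trans h)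
    rwa [funext (edgeBit_red d x)] at h1

theorem vtxFinite (d : ℕ) : Finite (Vtx d) := by
  induction d with
  | zero => exact inferInstanceAs (Finite Bool)
  | succ d ih => exact inferInstanceAs (Finite (Vtx d ⊕ (Edg d × Bool)))

theorem posWit_iff (d : ℕ) (x : Fin (2^(2*d)) → Bool) :
    posWit d x ≠ ⊤ ↔ PosW d (edgeBit d x) := by
  simp only [posWit, ne_eq, iInf_eq_top, ENNReal.ofReal_ne_top, imp_false, not_forall, not_not,
    Set.mem_ofPred_eq, PosW]
  refine exists_congr fun w => and_congr_right fun _ => ⟨fun h g => ?_, fun h v => ?_⟩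
  · have := vtxFinite d
    let _ := Fintype.ofFinite (Vtx d)
    have h1 : ∑ v, g v * (∑ p : Edg d × Bool, w p *
          ((if ep d p.1 p.2 = v then (1:ℝ) else 0) - (if ep d p.1 (!p.2) = v then 1 else 0)))
        = ∑ v, g v * ((if v = sVtx d then (1:ℝ) else 0) - (if v = tVtx d then 1 else 0)) :=
      Finset.sum_congr rfl fun v _ => by rw [h v]
    simp only [Finset.mul_sum] at h1
    rw [Finset.sum_comm] at h1
    have h2 : ∑ v, g v * ((if v = sVtx d then (1:ℝ) else 0) - (if v = tVtx d then 1 else 0))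
        = g (sVtx d) - g (tVtx d) := by
      simp [mul_sub, Finset.sum_sub_distrib]
    rw [h2] at h1
    rw [← h1]
    refine Finset.sum_congr rfl fun p _ => ?_
    simp only [mul_left_comm (g _) (w p)]
    rw [← Finset.mul_sum]
    simp [mul_sub, Finset.sum_sub_distrib]
  · have := h (fun u => if u = v then 1 else 0)
    simp only [eq_comm (a := v)]
    exact this

theorem negWit_iff (d : ℕ) (x : Fin (2^(2*d)) → Bool) :
    negWit d x ≠ ⊤ ↔ NegW d (edgeBit d x) := by
  simp only [negWit, ne_eq, iInf_eq_top, ENNReal.ofReal_ne_top, imp_false, not_forall, not_not,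
    Set.mem_ofPred_eq, NegW]

theorem not_both (d : ℕ) (f : Edg d → Bool) (hp : PosW d f) (hn : NegW d f) : False := by
  obtain ⟨w, hw, hg⟩ := hp
  obtain ⟨ω, h0, h1⟩ := hn
  have h := hg ω
  rw [h1, Finset.sum_eq_zero] at h
  · exact zero_ne_one h
  · intro p _
    by_cases hwp : w p = 0
    · rw [hwp, zero_mul]
    · rw [h0 p (hw p hwp), mul_zero]

/-- `w₊(x, P_{G_d})` is finite iff `NAND_{2d}(x) = 1`, and
`w₋(x, P_{G_d})` is finite iff `NAND_{2d}(x) = 0`: the span program `P_{G_d}` decides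
the depth-`2d` NAND-tree evaluation problem. -/
theorem spanProgram_decides_nand (d : ℕ) (x : Fin (2^(2*d)) → Bool) :
    (posWit d x ≠ ⊤ ↔ nand (2*d) x = true) ∧
    (negWit d x ≠ ⊤ ↔ nand (2*d) x = false) := by
  rw [posWit_iff, negWit_iff]
  cases h : nand (2*d) x
  · have hn := negW_of d x h
    exact ⟨⟨fun hp => (not_both d _ hp hn).elim, fun h => by simp at h⟩, fun _ => rfl, fun _ => hn⟩
  · have hp := posW_of d x h
    exact ⟨⟨fun _ => rfl, fun _ => hp⟩, fun hn => (not_both d _ hp hn).elim, fun h => by simp at h⟩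

end NandTree
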